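/- Let {X_t}_{t≥1} be a π-Harris ergodic Markov chain satisfying an l-step minorization P^l(x,A) ≥ h(x)Q(A). Then for any measurable function Ψ: X^∞ → ℝ^d, E_π[‖Ψ(X₁, X₂, X₃, …)‖] ≥ E_π[h(X)] · E_Q[‖Ψ(X₁, X₂, X₃, …)‖], where E_π and E_Q denote expectations for the chain started from X₁ ~ π and X₁ ~ Q respectively. -/

import Mathlib

open MeasureTheory ProbabilityTheory

/-- The `n`-step iterate of a Markov transition kernel. -/
noncomputable def kernelIter {𝒳 : Type*} [MeasurableSpace 𝒳] (P : Kernel 𝒳 𝒳) :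
    ℕ → Kernel 𝒳 𝒳
  | 0 => Kernel.id
  | n + 1 => P ∘ₖ kernelIter P n

/-- A measure invariant under `P` is invariant under every iterate of `P`. -/
lemma bind_kernelIter_eq_self {𝒳 : Type*} [MeasurableSpace 𝒳] {P : Kernel 𝒳 𝒳}
    {π : Measure 𝒳} (hinv : π.bind P = π) (n : ℕ) : π.bind (kernelIter P n) = π := by
  induction n with
  | zero => exact Measure.id_comp
  | succ n ih => rw [kernelIter, ← Measure.comp_assoc, ih, hinv]

/-- A minorization `h x • Q ≤ κ x` of a kernel with invariant measure `π` gives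
`(∫⁻ x, h x ∂π) • Q ≤ π`. -/
lemma lintegral_smul_le_of_minorization {𝒳 : Type*} [MeasurableSpace 𝒳] {κ : Kernel 𝒳 𝒳}
    {π Q : Measure 𝒳} (hinv : π.bind κ = π) {h : 𝒳 → ENNReal} (hmeas : Measurable h)
    (minor : ∀ x A, MeasurableSet A → h x * Q A ≤ κ x A) :
    (∫⁻ x, h x ∂π) • Q ≤ π := by
  refine Measure.le_iff.2 fun A hA => ?_
  calc ((∫⁻ x, h x ∂π) • Q) A = ∫⁻ x, h x * Q A ∂π := by
        rw [lintegral_mul_const _ hmeas, Measure.smul_apply, smul_eq_mul]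
    _ ≤ ∫⁻ x, κ x A ∂π := lintegral_mono fun x => minor x A hA
    _ = π A := by rw [← Measure.bind_apply hA κ.aemeasurable, hinv]

/-- for a Harris ergodic Markov chain with stationary distribution `π`
satisfying the `l`-step minorization `P^l(x,A) ≥ h(x) Q(A)`, and for every measurable path
functional `Ψ : 𝒳^∞ → ℝ^d`,
`E_π[‖Ψ(X₁, X₂, …)‖] ≥ E_π[h(X)] · E_Q[‖Ψ(X₁, X₂, …)‖]`.
Here `K` is the trajectory kernel of the chain (`K x` is the law of the whole path
`(X₁, X₂, …)` started from `X₁ = x`), so that the law of the path under initial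
distribution `F` is `F.bind K`, and the expectations are lower Lebesgue integrals. -/
theorem stmt8 {𝒳 : Type*} [MeasurableSpace 𝒳] (P : Kernel 𝒳 𝒳) [IsMarkovKernel P]
    (π : Measure 𝒳) [IsProbabilityMeasure π]
    (hinv : π.bind (fun x => P x) = π)
    (l : ℕ) (hl : 1 ≤ l)
    (h : 𝒳 → ℝ) (hmeas : Measurable h) (h01 : ∀ x, h x ∈ Set.Icc (0 : ℝ) 1)
    (Q : Measure 𝒳) [IsProbabilityMeasure Q]
    (minor : ∀ x A, MeasurableSet A → ENNReal.ofReal (h x) * Q A ≤ kernelIter P l x A)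
    (K : Kernel 𝒳 (ℕ → 𝒳)) [IsMarkovKernel K]
    (hK0 : ∀ x, Measure.map (fun ω : ℕ → 𝒳 => ω 0) (K x) = Measure.dirac x)
    (d : ℕ) (Ψ : (ℕ → 𝒳) → EuclideanSpace ℝ (Fin d)) (hΨ : Measurable Ψ) :
    ENNReal.ofReal (∫ x, h x ∂π) *
        ∫⁻ ω, ENNReal.ofReal ‖Ψ ω‖ ∂(Q.bind (fun x => K x))
      ≤ ∫⁻ ω, ENNReal.ofReal ‖Ψ ω‖ ∂(π.bind (fun x => K x)) := by
  have hint : ENNReal.ofReal (∫ x, h x ∂π) = ∫⁻ x, ENNReal.ofReal (h x) ∂π :=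
    ofReal_integral_eq_lintegral_ofReal
      (Integrable.of_mem_Icc 0 1 hmeas.aemeasurable (ae_of_all _ h01))
      (ae_of_all _ fun x => (h01 x).1)
  have hle := lintegral_smul_le_of_minorization (bind_kernelIter_eq_self hinv l)
    hmeas.ennreal_ofReal minor
  have hf : Measurable fun ω => ENNReal.ofReal ‖Ψ ω‖ := hΨ.norm.ennreal_ofReal
  rw [hint, Measure.lintegral_bind K.aemeasurable hf.aemeasurable,
    Measure.lintegral_bind K.aemeasurable hf.aemeasurable, ← smul_eq_mul,
    ← lintegral_smul_measure]
  exact lintegral_mono' hle le_rfl
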